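/- arXiv:2008.11020 — 10 statements merged into one kernel-verified Lean document; each statement's English description precedes it below -/
import Mathlib

section
/- For all real numbers k, v, y, the characteristic polynomial of the Gram matrix F_3(k,v,y) * (F_3(k,v,y))ᵀ equals (X − 9(k+v+y)²)·(X − 3(v+y)²)·(X − 3(v−y)²); consequently the singular values of F_3(k,v,y) are 3|k+v+y|, √3·|v+y|, and √3·|v−y|. -/
open Matrix Polynomial

/-- Frierson's order-3 pattern `M(v,y)`. -/
def Mmat (v y : ℝ) : Matrix (Fin 3) (Fin 3) ℝ :=
  !![2*v+y, 0, v+2*y; 2*y, v+y, 2*v; v, 2*v+2*y, y]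

/-- The 3×3 all-ones matrix. -/
def E3 : Matrix (Fin 3) (Fin 3) ℝ := Matrix.of fun _ _ => 1

/-- Frierson's parameterized order-3 magic square `F_3(k,v,y) = k•E_3 + M(v,y)`. -/
def F3 (k v y : ℝ) : Matrix (Fin 3) (Fin 3) ℝ := k • E3 + Mmat v y

/-- `σ` is a singular value of `A` iff `σ ≥ 0` and `σ²` is an eigenvalue of `A * Aᵀ`,
i.e. a root of the characteristic polynomial of the Gram matrix `A * Aᵀ`. -/
def IsSingularValue {n : ℕ} (A : Matrix (Fin n) (Fin n) ℝ) (σ : ℝ) : Prop :=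
  0 ≤ σ ∧ (A * Aᵀ).charpoly.IsRoot (σ ^ 2)

theorem F3_eq (k v y : ℝ) :
    F3 k v y = !![k + (2*v+y), k, k + (v+2*y); k + 2*y, k + (v+y), k + 2*v;
      k + v, k + (2*v+2*y), k + y] := by
  ext i j
  fin_cases i <;> fin_cases j <;> simp [F3, E3, Mmat]

theorem F3_gram_charpoly (k v y : ℝ) :
    (F3 k v y * (F3 k v y)ᵀ).charpoly =
      (X - C (9 * (k + v + y) ^ 2)) * (X - C (3 * (v + y) ^ 2)) *
        (X - C (3 * (v - y) ^ 2)) := by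
  rw [F3_eq, charpoly, det_fin_three]
  simp only [charmatrix_apply, mul_apply, transpose_apply, Fin.sum_univ_three]
  simp [C_ofNat]
  ring

/-- the characteristic polynomial of `F_3(k,v,y) * F_3(k,v,y)ᵀ` is
`(X − 9(k+v+y)²)(X − 3(v+y)²)(X − 3(v−y)²)`; consequently the singular values of
`F_3(k,v,y)` are `3|k+v+y|`, `√3·|v+y|` and `√3·|v−y|`. -/
theorem F3_gram_charpoly_and_singular_values (k v y : ℝ) :
    (F3 k v y * (F3 k v y)ᵀ).charpoly =
      (X - C (9 * (k + v + y) ^ 2)) * (X - C (3 * (v + y) ^ 2)) *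
        (X - C (3 * (v - y) ^ 2)) ∧
    IsSingularValue (F3 k v y) (3 * |k + v + y|) ∧
    IsSingularValue (F3 k v y) (Real.sqrt 3 * |v + y|) ∧
    IsSingularValue (F3 k v y) (Real.sqrt 3 * |v - y|) := by
  have h := F3_gram_charpoly k v y
  refine ⟨h, ⟨by positivity, ?_⟩, ⟨by positivity, ?_⟩, ⟨by positivity, ?_⟩⟩ <;>
    rw [h] <;> norm_num [mul_pow]
end

section
/- For real numbers k, v, y with k+v+y ≠ 0, v+y ≠ 0, and v ≠ y, the matrix F_3(k,v,y) has rank 3 (it is nonsingular). -/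
open Matrix Polynomial

/-- The determinant of `F_3(k,v,y)` in factored form. -/
theorem F3_det (k v y : ℝ) : (F3 k v y).det = 9 * (k + v + y) * (v + y) * (y - v) := by
  simp only [Matrix.det_fin_three, F3, E3, Mmat, Matrix.add_apply, Matrix.smul_apply,
    Matrix.of_apply, Matrix.cons_val, smul_eq_mul]
  ring

/-- if `k+v+y ≠ 0`, `v+y ≠ 0` and `v ≠ y` then `F_3(k,v,y)` has
rank 3 (it is nonsingular). -/
theorem F3_rank_three (k v y : ℝ) (h1 : k + v + y ≠ 0) (h2 : v + y ≠ 0)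
    (h3 : v ≠ y) : (F3 k v y).rank = 3 := by
  have hdet : (F3 k v y).det ≠ 0 := by
    rw [F3_det]
    exact mul_ne_zero (mul_ne_zero (mul_ne_zero (by norm_num) h1) h2) (sub_ne_zero.mpr h3.symm)
  simpa using Matrix.rank_of_isUnit _ ((Matrix.isUnit_iff_isUnit_det _).mpr hdet.isUnit)
end

section
/- There are exactly 8 matrices A : Fin 3 → Fin 3 → ℤ whose nine entries are a permutation of {1,2,...,9} and whose three row sums, three column sums, and two main diagonal sums all equal 15; that is, the order-3 magic square is unique up to the 8 rotations and reflections. -/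
open Matrix

/-- A 3×3 magic square on the integers 1,…,9: the nine entries are exactly the
integers 1 through 9 (each once), and all three row sums, all three column sums
and both main diagonal sums equal 15. -/
def IsMagic3 (A : Matrix (Fin 3) (Fin 3) ℤ) : Prop :=
  ((Finset.univ : Finset (Fin 3 × Fin 3)).image fun p => A p.1 p.2) =
      Finset.Icc 1 9 ∧
  (∀ i : Fin 3, ∑ j : Fin 3, A i j = 15) ∧
  (∀ j : Fin 3, ∑ i : Fin 3, A i j = 15) ∧
  (∑ i : Fin 3, A i i = 15) ∧
  (∑ i : Fin 3, A i (2 - i) = 15)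

noncomputable instance : DecidablePred IsMagic3 := fun A => by
  unfold IsMagic3
  infer_instance

/-- The square with all line sums 15 determined by its two upper corners `a` and `c`. -/
def squareOfCorners (p : ℤ × ℤ) : Matrix (Fin 3) (Fin 3) ℤ :=
  !![p.1, 15 - p.1 - p.2, p.2;
     5 + p.2 - p.1, 5, 5 + p.1 - p.2;
     10 - p.2, p.1 + p.2 - 5, 10 - p.1]

theorem squareOfCorners_injective : Function.Injective squareOfCorners := fun _ _ h =>
  Prod.ext (congrFun (congrFun h 0) 0) (congrFun (congrFun h 0) 2)

theorem IsMagic3.mem_Icc {A : Matrix (Fin 3) (Fin 3) ℤ} (h : IsMagic3 A) (i j : Fin 3) :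
    A i j ∈ Finset.Icc (1 : ℤ) 9 :=
  h.1 ▸ Finset.mem_image_of_mem (fun p : Fin 3 × Fin 3 => A p.1 p.2) (Finset.mem_univ (i, j))

theorem IsMagic3.eq_squareOfCorners {A : Matrix (Fin 3) (Fin 3) ℤ} (h : IsMagic3 A) :
    squareOfCorners (A 0 0, A 0 2) = A := by
  obtain ⟨-, hrow, hcol, hdiag, hanti⟩ := h
  simp only [Fin.forall_fin_succ, Fin.sum_univ_three] at hrow hcol hdiag hanti
  simp at hrow hcol hanti
  ext i j
  fin_cases i <;> fin_cases j <;> simp [squareOfCorners] <;> lia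

/-- The pairs of upper corners of magic squares. -/
noncomputable def magicCorners : Finset (ℤ × ℤ) :=
  (Finset.Icc 1 9 ×ˢ Finset.Icc 1 9).filter fun p => IsMagic3 (squareOfCorners p)

theorem card_magicCorners : magicCorners.card = 8 := by
  decide +kernel

theorem setOf_isMagic3_eq_image :
    {A : Matrix (Fin 3) (Fin 3) ℤ | IsMagic3 A} = squareOfCorners '' magicCorners := by
  ext A
  simp only [Set.mem_ofPred_eq, Set.mem_image, Finset.mem_coe, magicCorners, Finset.mem_filter,
    Finset.mem_product]
  constructor
  · intro h
    refine ⟨(A 0 0, A 0 2), ⟨⟨h.mem_Icc 0 0, h.mem_Icc 0 2⟩, ?_⟩, h.eq_squareOfCorners⟩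
    rwa [h.eq_squareOfCorners]
  · rintro ⟨p, ⟨-, hp⟩, rfl⟩
    exact hp

/-- there are exactly 8 order-3 magic squares on 1,…,9, i.e. the
order-3 magic square is unique up to the 8 rotations and reflections. -/
theorem eight_order_three_magic_squares :
    {A : Matrix (Fin 3) (Fin 3) ℤ | IsMagic3 A}.ncard = 8 := by
  rw [setOf_isMagic3_eq_image, Set.ncard_image_of_injective _ squareOfCorners_injective,
    Set.ncard_coe_finset, card_magicCorners]
end

section
/- For all real numbers k, v, y, s, t, every row sum, every column sum, and both main diagonal sums of the 9×9 matrix F_9(k,v,y,s,t) equal 9(k+v+y+s+t); that is, F_9(k,v,y,s,t) is a magic square with magic line sum 9(k+v+y+s+t). -/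
open Matrix Polynomial

/-- Frierson's order-9 compound square
`F_9(k,v,y,s,t) = k•E_9 + E_3 ⊗ M(v,y) + M(s,t) ⊗ E_3`: its 3×3 block in block
position `(a,b)` (occupying rows `3a+i`, columns `3b+j`) is
`M(v,y) + (k + M(s,t)_{a,b}) • E_3`. -/
def F9 (k v y s t : ℝ) : Matrix (Fin 9) (Fin 9) ℝ :=
  Matrix.of fun i j =>
    k + Mmat v y ⟨i.val % 3, by omega⟩ ⟨j.val % 3, by omega⟩
      + Mmat s t ⟨i.val / 3, by omega⟩ ⟨j.val / 3, by omega⟩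

theorem Mmat_row_sum (v y : ℝ) (i : Fin 3) : ∑ j, Mmat v y i j = 3 * (v + y) := by
  fin_cases i <;> simp [Mmat, Fin.sum_univ_three] <;> ring

theorem Mmat_col_sum (v y : ℝ) (j : Fin 3) : ∑ i, Mmat v y i j = 3 * (v + y) := by
  fin_cases j <;> simp [Mmat, Fin.sum_univ_three] <;> ring

theorem Mmat_diag_sum (v y : ℝ) : ∑ i, Mmat v y i i = 3 * (v + y) := by
  simp [Mmat, Fin.sum_univ_three]; ring

theorem Mmat_antidiag_sum (v y : ℝ) : ∑ i, Mmat v y i (2 - i) = 3 * (v + y) := by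
  simp [Mmat, Fin.sum_univ_three]; ring

/-- Summing over `Fin 9` a constant plus functions of the two base-3 digits. -/
theorem sum_const_add_digits (k : ℝ) (f g : Fin 3 → ℝ) :
    ∑ i : Fin 9, (k + f ⟨i.val % 3, by omega⟩ + g ⟨i.val / 3, by omega⟩) =
      9 * k + 3 * ∑ a, f a + 3 * ∑ a, g a := by
  simp [Fin.sum_univ_succ]; ring

theorem F9_antidiag (k v y s t : ℝ) (i : Fin 9) :
    F9 k v y s t i (8 - i) =
      k + Mmat v y ⟨i.val % 3, by omega⟩ (2 - ⟨i.val % 3, by omega⟩)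
        + Mmat s t ⟨i.val / 3, by omega⟩ (2 - ⟨i.val / 3, by omega⟩) := by
  fin_cases i <;> rfl

/-- every row sum, column sum and both main diagonal sums of the
9×9 matrix `F_9(k,v,y,s,t)` equal `9(k+v+y+s+t)`. -/
theorem F9_is_magic (k v y s t : ℝ) :
    (∀ i : Fin 9, ∑ j : Fin 9, F9 k v y s t i j = 9 * (k + v + y + s + t)) ∧
    (∀ j : Fin 9, ∑ i : Fin 9, F9 k v y s t i j = 9 * (k + v + y + s + t)) ∧
    (∑ i : Fin 9, F9 k v y s t i i = 9 * (k + v + y + s + t)) ∧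
    (∑ i : Fin 9, F9 k v y s t i (8 - i) = 9 * (k + v + y + s + t)) := by
  refine ⟨fun i => ?_, fun j => ?_, ?_, ?_⟩
  · simp only [F9, of_apply]
    rw [sum_const_add_digits k (Mmat v y _) (Mmat s t _), Mmat_row_sum, Mmat_row_sum]
    ring
  · simp only [F9, of_apply]
    rw [sum_const_add_digits k (Mmat v y · _) (Mmat s t · _), Mmat_col_sum, Mmat_col_sum]
    ring
  · simp only [F9, of_apply]
    rw [sum_const_add_digits k (fun a => Mmat v y a a) (fun a => Mmat s t a a),
      Mmat_diag_sum, Mmat_diag_sum]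
    ring
  · simp only [F9_antidiag]
    rw [sum_const_add_digits k (fun a => Mmat v y a (2 - a)) (fun a => Mmat s t a (2 - a)),
      Mmat_antidiag_sum, Mmat_antidiag_sum]
    ring
end

section
/- For all real numbers k, v, y, s, t and all indices i, j in Fin 9, the entries of F_9(k,v,y,s,t) at position (i,j) and at the antipodal position (8−i, 8−j) sum to 2(k+v+y+s+t); that is, F_9(k,v,y,s,t) is an associative magic square. -/
open Matrix Polynomial

/-- Antipodal entries of Frierson's order-3 pattern sum to `2(v+y)`. -/
lemma Mmat_add_rev (v y : ℝ) (a b : Fin 3) :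
    Mmat v y a b + Mmat v y a.rev b.rev = 2 * (v + y) := by
  fin_cases a <;> fin_cases b <;> simp [Mmat, Fin.rev] <;> ring

/-- Reflecting an index of `Fin 9` reflects its base-3 digits. -/
lemma base_three_digits_sub (i : Fin 9) :
    (⟨(8 - i).val % 3, by omega⟩ : Fin 3) = Fin.rev ⟨i.val % 3, by omega⟩ ∧
      (⟨(8 - i).val / 3, by omega⟩ : Fin 3) = Fin.rev ⟨i.val / 3, by omega⟩ := by
  revert i
  decide

/-- `F_9(k,v,y,s,t)` is an associative magic square: the entries
at `(i,j)` and at the antipodal position `(8−i, 8−j)` sum to `2(k+v+y+s+t)`. -/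
theorem F9_is_associative (k v y s t : ℝ) (i j : Fin 9) :
    F9 k v y s t i j + F9 k v y s t (8 - i) (8 - j) =
      2 * (k + v + y + s + t) := by
  simp only [F9, Matrix.of_apply, base_three_digits_sub]
  linear_combination
    Mmat_add_rev v y ⟨i.val % 3, by omega⟩ ⟨j.val % 3, by omega⟩ +
      Mmat_add_rev s t ⟨i.val / 3, by omega⟩ ⟨j.val / 3, by omega⟩
end

section
/- For all real numbers k, v, y, s, t and every block position (a,b) in Fin 3 × Fin 3, the 3×3 tiled subsquare of F_9(k,v,y,s,t) in block position (a,b) is itself a magic square: all of its row sums, column sums, and both of its diagonal sums equal 3(k+v+y) + 3·M(s,t)_{a,b}. -/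
open Matrix Polynomial

/-- The 3×3 tiled subsquare of `F_9(k,v,y,s,t)` in block position `(a,b)`:
entries at positions `(3a+i, 3b+j)` for `i j : Fin 3`. -/
def block9 (k v y s t : ℝ) (a b : Fin 3) : Matrix (Fin 3) (Fin 3) ℝ :=
  Matrix.of fun i j =>
    F9 k v y s t ⟨3 * a.val + i.val, by omega⟩ ⟨3 * b.val + j.val, by omega⟩

/-- Each tiled subsquare is the order-3 pattern shifted by a constant. -/
theorem block9_apply (k v y s t : ℝ) (a b i j : Fin 3) :
    block9 k v y s t a b i j = k + Mmat v y i j + Mmat s t a b := by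
  have hmod (c d : Fin 3) : (3 * c.val + d.val) % 3 = d.val := by omega
  have hdiv (c d : Fin 3) : (3 * c.val + d.val) / 3 = c.val := by omega
  simp [block9, F9, hmod, hdiv]

/-- every tiled 3×3 subsquare of `F_9(k,v,y,s,t)` is itself a
magic square, with all row sums, column sums and both diagonal sums equal to
`3(k+v+y) + 3·M(s,t)_{a,b}`. -/
theorem F9_blocks_are_magic (k v y s t : ℝ) (a b : Fin 3) :
    (∀ i : Fin 3, ∑ j : Fin 3, block9 k v y s t a b i j =
      3 * (k + v + y) + 3 * Mmat s t a b) ∧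
    (∀ j : Fin 3, ∑ i : Fin 3, block9 k v y s t a b i j =
      3 * (k + v + y) + 3 * Mmat s t a b) ∧
    (∑ i : Fin 3, block9 k v y s t a b i i =
      3 * (k + v + y) + 3 * Mmat s t a b) ∧
    (∑ i : Fin 3, block9 k v y s t a b i (2 - i) =
      3 * (k + v + y) + 3 * Mmat s t a b) := by
  simp only [block9_apply, Fin.sum_univ_three]
  refine ⟨fun i => ?_, fun j => ?_, ?_, ?_⟩
  · fin_cases i <;> simp [Mmat] <;> ring
  · fin_cases j <;> simp [Mmat] <;> ring
  · simp [Mmat]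
    ring
  · have h₁ : (2 - 1 : Fin 3) = 1 := rfl
    simp [Mmat, h₁]
    ring
end

section
/- For all real numbers k, v, y, s, t, the 3×3 matrix S whose (a,b) entry is the sum of all nine entries of the tiled 3×3 subsquare of F_9(k,v,y,s,t) in block position (a,b) is itself a magic square: all row sums, column sums, and both diagonal sums of S equal 27(k+v+y+s+t). (Cammann's observation that the subsquare sums of a compound magic square form a magic square.) -/
open Matrix Polynomial

/-- The 3×3 matrix of subsquare sums: its `(a,b)` entry is the sum of the nine
entries of the tiled 3×3 subsquare of `F_9(k,v,y,s,t)` in block position `(a,b)`. -/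
def blockSums9 (k v y s t : ℝ) : Matrix (Fin 3) (Fin 3) ℝ :=
  Matrix.of fun a b => ∑ i : Fin 3, ∑ j : Fin 3,
    F9 k v y s t ⟨3 * a.val + i.val, by omega⟩ ⟨3 * b.val + j.val, by omega⟩

theorem F9_apply_block (k v y s t : ℝ) (a b i j : Fin 3) :
    F9 k v y s t ⟨3 * a.val + i.val, by omega⟩ ⟨3 * b.val + j.val, by omega⟩ =
      k + Mmat v y i j + Mmat s t a b := by
  have hmod (c l : Fin 3) : (3 * c.val + l.val) % 3 = l.val := by omega
  have hdiv (c l : Fin 3) : (3 * c.val + l.val) / 3 = c.val := by omega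
  simp only [F9, Matrix.of_apply, hmod, hdiv]

theorem blockSums9_apply (k v y s t : ℝ) (a b : Fin 3) :
    blockSums9 k v y s t a b = 9 * (k + v + y + Mmat s t a b) := by
  simp only [blockSums9, Matrix.of_apply, F9_apply_block, Fin.sum_univ_three]
  simp [Mmat]
  ring

/-- Cammann: the matrix of subsquare sums of `F_9(k,v,y,s,t)` is
itself a magic square with line sum `27(k+v+y+s+t)`. -/
theorem F9_block_sums_magic (k v y s t : ℝ) :
    (∀ a : Fin 3, ∑ b : Fin 3, blockSums9 k v y s t a b =
      27 * (k + v + y + s + t)) ∧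
    (∀ b : Fin 3, ∑ a : Fin 3, blockSums9 k v y s t a b =
      27 * (k + v + y + s + t)) ∧
    (∑ a : Fin 3, blockSums9 k v y s t a a = 27 * (k + v + y + s + t)) ∧
    (∑ a : Fin 3, blockSums9 k v y s t a (2 - a) =
      27 * (k + v + y + s + t)) := by
  simp only [blockSums9_apply, Fin.sum_univ_three]
  refine ⟨fun a => ?_, fun b => ?_, ?_, ?_⟩
  · fin_cases a <;> simp [Mmat] <;> ring
  · fin_cases b <;> simp [Mmat] <;> ring
  · simp [Mmat]
    ring
  · simp [Mmat]
    ring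
end

section
/- For all real numbers k, v, y, s, t, the characteristic polynomial of the 9×9 Gram matrix F_9(k,v,y,s,t) * (F_9(k,v,y,s,t))ᵀ equals X⁴ · (X − 81(k+v+y+s+t)²) · (X − 27(v+y)²) · (X − 27(v−y)²) · (X − 27(s+t)²) · (X − 27(s−t)²); consequently the nonzero singular values of F_9 are 9|k+v+y+s+t|, √27·|v±y|, and √27·|s±t|, and F_9 has at most 5 nonzero singular values. -/
open Matrix Polynomial

/-- The antisymmetric singular vector of Frierson's order-3 pattern. -/
def friersonOdd : Fin 3 → ℝ := ![1, 0, -1]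

/-- The symmetric singular vector of Frierson's order-3 pattern. -/
noncomputable def friersonEven : Fin 3 → ℝ := ![1 / 2, -1, 1 / 2]

/-- The left singular vectors of `F9`, up to normalization, as columns. -/
noncomputable def F9Left : Matrix (Fin 9) (Fin 5) ℝ :=
  Matrix.of fun i =>
    ![1, friersonOdd ⟨i.val % 3, by omega⟩, friersonEven ⟨i.val % 3, by omega⟩,
      friersonOdd ⟨i.val / 3, by omega⟩, friersonEven ⟨i.val / 3, by omega⟩]

/-- The right singular vectors of `F9`, up to normalization, as columns. -/
noncomputable def F9Right : Matrix (Fin 9) (Fin 5) ℝ :=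
  F9Left.submatrix id ![0, 2, 1, 4, 3]

/-- The coefficients of `F9` with respect to `F9Left` and `F9Right`. -/
def F9Coeff (k v y s t : ℝ) : Fin 5 → ℝ :=
  ![k + v + y + s + t, v + y, v - y, s + t, s - t]

lemma Mmat_apply (v y : ℝ) (i j : Fin 3) :
    Mmat v y i j = (v + y) + (v + y) * friersonOdd i * friersonEven j +
      (v - y) * friersonEven i * friersonOdd j := by
  fin_cases i <;> fin_cases j <;> simp [Mmat, friersonOdd, friersonEven] <;> ring

lemma F9_eq_mul (k v y s t : ℝ) :
    F9 k v y s t = F9Left * (diagonal (F9Coeff k v y s t) * F9Rightᵀ) := by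
  ext i j
  simp only [F9, of_apply, Mmat_apply, mul_apply, transpose_apply]
  simp [Fin.sum_univ_five, F9Left, F9Right, F9Coeff]
  ring

lemma F9Left_gram : F9Leftᵀ * F9Left = diagonal ![9, 6, 9 / 2, 6, 9 / 2] := by
  ext i j
  fin_cases i <;> fin_cases j <;>
    norm_num [mul_apply, Fin.sum_univ_succ, F9Left, friersonOdd, friersonEven, diagonal_apply]

lemma F9Right_gram : F9Rightᵀ * F9Right = diagonal ![9, 9 / 2, 6, 9 / 2, 6] := by
  have h : F9Rightᵀ * F9Right = (F9Leftᵀ * F9Left).submatrix ![0, 2, 1, 4, 3] ![0, 2, 1, 4, 3] :=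
    rfl
  rw [h, F9Left_gram]
  ext i j
  fin_cases i <;> fin_cases j <;> simp

lemma F9_gram_charpoly_eq (k v y s t : ℝ) :
    (F9 k v y s t * (F9 k v y s t)ᵀ).charpoly =
      X ^ 4 * (X - C (81 * (k + v + y + s + t) ^ 2)) *
        (X - C (27 * (v + y) ^ 2)) * (X - C (27 * (v - y) ^ 2)) *
        (X - C (27 * (s + t) ^ 2)) * (X - C (27 * (s - t) ^ 2)) := by
  have hfac : F9 k v y s t * (F9 k v y s t)ᵀ =
      F9Left * (diagonal (F9Coeff k v y s t) * (F9Rightᵀ * F9Right) *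
        diagonal (F9Coeff k v y s t) * F9Leftᵀ) := by
    simp only [F9_eq_mul, transpose_mul, diagonal_transpose, transpose_transpose,
      Matrix.mul_assoc]
  have hdiag : diagonal (F9Coeff k v y s t) * (F9Rightᵀ * F9Right) *
      diagonal (F9Coeff k v y s t) * F9Leftᵀ * F9Left =
      diagonal ![81 * (k + v + y + s + t) ^ 2, 27 * (v + y) ^ 2, 27 * (v - y) ^ 2,
        27 * (s + t) ^ 2, 27 * (s - t) ^ 2] := by
    rw [Matrix.mul_assoc _ F9Leftᵀ, F9Left_gram, F9Right_gram]
    simp only [diagonal_mul_diagonal]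
    congr 1
    ext i
    fin_cases i <;> simp [F9Coeff] <;> ring
  rw [hfac, charpoly_mul_comm_of_le _ _ (by simp), hdiag, charpoly_diagonal,
    Fin.prod_univ_five]
  simp only [Fintype.card_fin, Nat.reduceSub, cons_val, mul_assoc]

lemma F9_rank_le (k v y s t : ℝ) : (F9 k v y s t).rank ≤ 5 := by
  rw [F9_eq_mul]
  exact (rank_mul_le_left _ _).trans (by simpa using F9Left.rank_le_width)

/-- the characteristic polynomial of the Gram matrix
`F_9 * F_9ᵀ` equals
`X⁴·(X − 81(k+v+y+s+t)²)·(X − 27(v+y)²)·(X − 27(v−y)²)·(X − 27(s+t)²)·(X − 27(s−t)²)`;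
consequently the nonzero singular values of `F_9` are `9|k+v+y+s+t|`,
`√27·|v±y|` and `√27·|s±t|`, and `F_9` has at most 5 nonzero singular values
(rank at most 5). -/
theorem F9_gram_charpoly (k v y s t : ℝ) :
    (F9 k v y s t * (F9 k v y s t)ᵀ).charpoly =
      X ^ 4 * (X - C (81 * (k + v + y + s + t) ^ 2)) *
        (X - C (27 * (v + y) ^ 2)) * (X - C (27 * (v - y) ^ 2)) *
        (X - C (27 * (s + t) ^ 2)) * (X - C (27 * (s - t) ^ 2)) ∧
    IsSingularValue (F9 k v y s t) (9 * |k + v + y + s + t|) ∧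
    IsSingularValue (F9 k v y s t) (Real.sqrt 27 * |v + y|) ∧
    IsSingularValue (F9 k v y s t) (Real.sqrt 27 * |v - y|) ∧
    IsSingularValue (F9 k v y s t) (Real.sqrt 27 * |s + t|) ∧
    IsSingularValue (F9 k v y s t) (Real.sqrt 27 * |s - t|) ∧
    (F9 k v y s t).rank ≤ 5 := by
  have h27 : Real.sqrt 27 ^ 2 = 27 := Real.sq_sqrt (by norm_num)
  refine ⟨F9_gram_charpoly_eq k v y s t, ⟨by positivity, ?_⟩, ⟨by positivity, ?_⟩,
    ⟨by positivity, ?_⟩, ⟨by positivity, ?_⟩, ⟨by positivity, ?_⟩, F9_rank_le k v y s t⟩ <;>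
  · rw [F9_gram_charpoly_eq, mul_pow, sq_abs]
    norm_num [IsRoot.def, h27]
end

section
/- For all real numbers k, v, y, s, t, the Gram matrices of F_9(k,v,y,s,t) and of F_9(k,s,t,v,y) have equal characteristic polynomials; hence the two compound magic squares obtained by exchanging the couple (v,y) with the couple (s,t) have identical singular values (Frierson's isentropic partner pairs, e.g. T_9A and T_9D). -/
open Matrix Polynomial

/-- The exchange of the base-3 digits of an element of `Fin 9`, as a permutation. -/
def digitSwap : Equiv.Perm (Fin 9) :=
  Function.Involutive.toPerm (fun i => ⟨3 * (i.val % 3) + i.val / 3, by omega⟩) fun i => by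
    ext
    dsimp only
    omega

/-- Exchanging the couples `(v,y)` and `(s,t)` amounts to a simultaneous row and column
permutation of the compound square. -/
theorem F9_swap_eq_reindex (k v y s t : ℝ) :
    F9 k s t v y = Matrix.reindex digitSwap digitSwap (F9 k v y s t) := by
  have h_mod (i : Fin 9) : (digitSwap.symm i).val % 3 = i.val / 3 := by
    change (3 * (i.val % 3) + i.val / 3) % 3 = _
    omega
  have h_div (i : Fin 9) : (digitSwap.symm i).val / 3 = i.val % 3 := by
    change (3 * (i.val % 3) + i.val / 3) / 3 = _
    omega
  ext i j
  simp only [F9, Matrix.reindex_apply, Matrix.submatrix_apply, Matrix.of_apply, h_mod, h_div]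
  ring

/-- the Gram matrices of `F_9(k,v,y,s,t)` and of `F_9(k,s,t,v,y)`
have equal characteristic polynomials; hence the two compound magic squares
obtained by exchanging the couple `(v,y)` with the couple `(s,t)` have
identical singular values (Frierson's isentropic partner pairs). -/
theorem F9_partner_isospectral (k v y s t : ℝ) :
    (F9 k v y s t * (F9 k v y s t)ᵀ).charpoly =
      (F9 k s t v y * (F9 k s t v y)ᵀ).charpoly := by
  rw [F9_swap_eq_reindex k v y s t, ← Matrix.charpoly_reindex digitSwap]
  simp only [Matrix.reindex_apply, Matrix.transpose_submatrix, Matrix.submatrix_mul_equiv]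
end

section
/- The entries of the order-27 compound magic square F_27A := F_27(1,3,1,27,9,243,81) are exactly the integers 1 through 729, each occurring exactly once; that is, the map (i,j) ↦ F_27A i j is a bijection from Fin 27 × Fin 27 onto {1, 2, ..., 729}. -/
open Matrix

/-- Frierson's order-3 pattern `M(v,y)`, with integer entries. -/
def MmatZ (v y : ℤ) : Matrix (Fin 3) (Fin 3) ℤ :=
  !![2*v+y, 0, v+2*y; 2*y, v+y, 2*v; v, 2*v+2*y, y]

/-- The order-27 compound square over ℤ,
`F_27(k,v,y,s,t,p,q) = k•E_27 + E_3⊗E_3⊗M(v,y) + E_3⊗M(s,t)⊗E_3 + M(p,q)⊗E_3⊗E_3`: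
the entry at position `(i,j)` is
`k + M(v,y)_{i%3, j%3} + M(s,t)_{i/3%3, j/3%3} + M(p,q)_{i/9, j/9}`. -/
def F27Z (k v y s t p q : ℤ) : Matrix (Fin 27) (Fin 27) ℤ :=
  Matrix.of fun i j =>
    k + MmatZ v y ⟨i.val % 3, by omega⟩ ⟨j.val % 3, by omega⟩
      + MmatZ s t ⟨i.val / 3 % 3, by omega⟩ ⟨j.val / 3 % 3, by omega⟩
      + MmatZ p q ⟨i.val / 9, by omega⟩ ⟨j.val / 9, by omega⟩

/-- The lowest-entropy order-27 compound magic square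
`F_27A = F_27(1,3,1,27,9,243,81)`. -/
def F27A : Matrix (Fin 27) (Fin 27) ℤ := F27Z 1 3 1 27 9 243 81

theorem MmatZ_mul (c v y : ℤ) (a b : Fin 3) :
    MmatZ (c * v) (c * y) a b = c * MmatZ v y a b := by
  fin_cases a <;> fin_cases b <;> simp [MmatZ] <;> ring

/-- `M(3,1)` has exactly the entries `0, …, 8`, each occurring once. -/
theorem MmatZ_three_one_bijOn :
    Set.BijOn (fun p : Fin 3 × Fin 3 => MmatZ 3 1 p.1 p.2) Set.univ (Set.Icc 0 8) := by
  refine ⟨fun p _ => ?_, fun p _ q _ => ?_, fun n hn => ?_⟩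
  · revert p; decide
  · revert p q; decide
  · obtain ⟨h0, h8⟩ := hn
    simp only [Set.image_univ, Set.mem_range]
    interval_cases n <;> decide

/-- The entries of `F_27A` in base 9: the digits are entries of `M(3,1)`. -/
theorem F27A_apply (i j : Fin 27) :
    F27A i j = 1 + MmatZ 3 1 ⟨i.val % 3, by omega⟩ ⟨j.val % 3, by omega⟩
      + 9 * MmatZ 3 1 ⟨i.val / 3 % 3, by omega⟩ ⟨j.val / 3 % 3, by omega⟩
      + 81 * MmatZ 3 1 ⟨i.val / 9, by omega⟩ ⟨j.val / 9, by omega⟩ := by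
  rw [← MmatZ_mul, ← MmatZ_mul]
  rfl

/-- the entries of `F_27A` are exactly the integers 1 through
729, each occurring exactly once: `(i,j) ↦ F_27A i j` is a bijection from
`Fin 27 × Fin 27` onto `{1, 2, …, 729}`. -/
theorem F27A_entries_bijective :
    Set.BijOn (fun p : Fin 27 × Fin 27 => F27A p.1 p.2) Set.univ
      (Set.Icc (1 : ℤ) 729) := by
  obtain ⟨maps, inj, surj⟩ := MmatZ_three_one_bijOn
  have bounds (a b : Fin 3) : 0 ≤ MmatZ 3 1 a b ∧ MmatZ 3 1 a b ≤ 8 :=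
    maps (Set.mem_univ (a, b))
  have digit_inj {a b c d : Fin 3} (h : MmatZ 3 1 a b = MmatZ 3 1 c d) :
      a.val = c.val ∧ b.val = d.val := by
    have := inj (Set.mem_univ (a, b)) (Set.mem_univ (c, d)) h
    simp_all
  refine ⟨fun ⟨i, j⟩ _ => ?_, fun ⟨i, j⟩ _ ⟨i', j'⟩ _ h => ?_, fun n ⟨h1, h2⟩ => ?_⟩
  · simp only [F27A_apply, Set.mem_Icc]
    have h₀ := bounds ⟨i.val % 3, by omega⟩ ⟨j.val % 3, by omega⟩
    have h₁ := bounds ⟨i.val / 3 % 3, by omega⟩ ⟨j.val / 3 % 3, by omega⟩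
    have h₂ := bounds ⟨i.val / 9, by omega⟩ ⟨j.val / 9, by omega⟩
    omega
  · simp only [F27A_apply] at h
    have h₀ := bounds ⟨i.val % 3, by omega⟩ ⟨j.val % 3, by omega⟩
    have h₁ := bounds ⟨i.val / 3 % 3, by omega⟩ ⟨j.val / 3 % 3, by omega⟩
    have h₀' := bounds ⟨i'.val % 3, by omega⟩ ⟨j'.val % 3, by omega⟩
    have h₁' := bounds ⟨i'.val / 3 % 3, by omega⟩ ⟨j'.val / 3 % 3, by omega⟩
    have e₀ := digit_inj (a := ⟨i.val % 3, by omega⟩) (b := ⟨j.val % 3, by omega⟩)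
      (c := ⟨i'.val % 3, by omega⟩) (d := ⟨j'.val % 3, by omega⟩) (by omega)
    have e₁ := digit_inj (a := ⟨i.val / 3 % 3, by omega⟩) (b := ⟨j.val / 3 % 3, by omega⟩)
      (c := ⟨i'.val / 3 % 3, by omega⟩) (d := ⟨j'.val / 3 % 3, by omega⟩) (by omega)
    have e₂ := digit_inj (a := ⟨i.val / 9, by omega⟩) (b := ⟨j.val / 9, by omega⟩)
      (c := ⟨i'.val / 9, by omega⟩) (d := ⟨j'.val / 9, by omega⟩) (by omega)
    simp only at e₀ e₁ e₂
    ext <;> simp only <;> omega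
  · have digit (m : ℤ) (h₀ : 0 ≤ m) (h₈ : m ≤ 8) : ∃ a b, MmatZ 3 1 a b = m := by
      obtain ⟨⟨a, b⟩, -, h⟩ := surj ⟨h₀, h₈⟩
      exact ⟨a, b, h⟩
    obtain ⟨a₀, b₀, h₀⟩ := digit ((n - 1) % 9) (by omega) (by omega)
    obtain ⟨a₁, b₁, h₁⟩ := digit ((n - 1) / 9 % 9) (by omega) (by omega)
    obtain ⟨a₂, b₂, h₂⟩ := digit ((n - 1) / 81) (by omega) (by omega)
    have low (x y z : Fin 3) : (9 * x.val + 3 * y.val + z.val) % 3 = z.val := by omega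
    have mid (x y z : Fin 3) : (9 * x.val + 3 * y.val + z.val) / 3 % 3 = y.val := by omega
    have high (x y z : Fin 3) : (9 * x.val + 3 * y.val + z.val) / 9 = x.val := by omega
    refine ⟨(⟨9 * a₂.val + 3 * a₁.val + a₀.val, by omega⟩,
      ⟨9 * b₂.val + 3 * b₁.val + b₀.val, by omega⟩), Set.mem_univ _, ?_⟩
    simp only [F27A_apply, low, mid, high, Fin.eta, h₀, h₁, h₂]
    omega
end
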